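/- Let B0, C1 ∈ ℝ, let (P1, P2, E1) be a C¹ solution of the characteristic system dP1/dθ = −E1 − B0 P2/γ, dP2/dθ = B0 P1/γ, dE1/dθ = P1/γ (γ = √(1+P1²+P2²)) on an interval I, and let (p1, p2, e) be a C¹ solution of the extended system dp1/dθ = −q1 p1 − B0 q2 − e, dp2/dθ = −q1 p2 + B0 q1, de/dθ = (1 − e) q1 with qᵢ = pᵢ/γ − Pᵢ(p1P1 + p2P2)/γ³, such that p1 ≠ 0 on I and p2 − B0 = C1(e − 1) on I. Define u = e/p1, λ = (e−1)/p1 and the functions F1 = (1+P1²)/γ³, F2 = P1P2/γ³, F3 = (1+P2²)/γ³ of θ. Then on I: du/dθ = (1 + B0² F1) u² + B0(C1 − B0) F1 uλ − 2 B0 F2 u − (C1 − B0) F2 λ + F3, and dλ/dθ = (1 + B0² F1) uλ + B0(C1 − B0) F1 λ² − B0 F2 λ. -/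

import Mathlib

open Real Set

/-- The Lorentz factor `γ = √(1 + P1² + P2²)` along a characteristic. -/
noncomputable def gam (P1 P2 : ℝ → ℝ) (θ : ℝ) : ℝ :=
  Real.sqrt (1 + P1 θ ^ 2 + P2 θ ^ 2)

/-- `Q = (p1 P1 + p2 P2)/γ³`. -/
noncomputable def Qv (P1 P2 p1 p2 : ℝ → ℝ) (θ : ℝ) : ℝ :=
  (p1 θ * P1 θ + p2 θ * P2 θ) / (gam P1 P2 θ) ^ 3

/-- `q1 = p1/γ − P1 (p1 P1 + p2 P2)/γ³`. -/
noncomputable def q1v (P1 P2 p1 p2 : ℝ → ℝ) (θ : ℝ) : ℝ :=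
  p1 θ / gam P1 P2 θ - P1 θ * Qv P1 P2 p1 p2 θ

/-- `q2 = p2/γ − P2 (p1 P1 + p2 P2)/γ³`. -/
noncomputable def q2v (P1 P2 p1 p2 : ℝ → ℝ) (θ : ℝ) : ℝ :=
  p2 θ / gam P1 P2 θ - P2 θ * Qv P1 P2 p1 p2 θ

/-- `F1 = (1 + P1²)/γ³`. -/
noncomputable def F1v (P1 P2 : ℝ → ℝ) (θ : ℝ) : ℝ :=
  (1 + P1 θ ^ 2) / (gam P1 P2 θ) ^ 3

/-- `F2 = P1 P2/γ³`. -/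
noncomputable def F2v (P1 P2 : ℝ → ℝ) (θ : ℝ) : ℝ :=
  P1 θ * P2 θ / (gam P1 P2 θ) ^ 3

/-- `F3 = (1 + P2²)/γ³`. -/
noncomputable def F3v (P1 P2 : ℝ → ℝ) (θ : ℝ) : ℝ :=
  (1 + P2 θ ^ 2) / (gam P1 P2 θ) ^ 3

lemma gam_pos (P1 P2 : ℝ → ℝ) (θ : ℝ) : 0 < gam P1 P2 θ :=
  Real.sqrt_pos.mpr (by positivity)

lemma gam_sq (P1 P2 : ℝ → ℝ) (θ : ℝ) : gam P1 P2 θ ^ 2 = 1 + P1 θ ^ 2 + P2 θ ^ 2 :=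
  Real.sq_sqrt (by positivity)

lemma q1v_eq (P1 P2 p1 p2 : ℝ → ℝ) (θ : ℝ) :
    q1v P1 P2 p1 p2 θ = F3v P1 P2 θ * p1 θ - F2v P1 P2 θ * p2 θ := by
  have hg := (gam_pos P1 P2 θ).ne'
  have hs := gam_sq P1 P2 θ
  unfold q1v Qv F3v F2v
  field_simp
  rw [hs]
  ring

lemma q2v_eq (P1 P2 p1 p2 : ℝ → ℝ) (θ : ℝ) :
    q2v P1 P2 p1 p2 θ = F1v P1 P2 θ * p2 θ - F2v P1 P2 θ * p1 θ := by
  have hg := (gam_pos P1 P2 θ).ne'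
  have hs := gam_sq P1 P2 θ
  unfold q2v Qv F1v F2v
  field_simp
  rw [hs]
  ring

/-- After eliminating `σ` via the first integral `p2 − B0 = C1 (e − 1)`, the variables
`u = e/p1` and `λ = (e−1)/p1` satisfy the closed system (17) of the paper. -/
theorem u_lambda_reduced_system
    (B0 C1 : ℝ) (I : Set ℝ) (P1 P2 E1 p1 p2 e : ℝ → ℝ)
    (hP1 : ∀ θ ∈ I, HasDerivAt P1 (-(E1 θ) - B0 * P2 θ / gam P1 P2 θ) θ)
    (hP2 : ∀ θ ∈ I, HasDerivAt P2 (B0 * P1 θ / gam P1 P2 θ) θ)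
    (hE1 : ∀ θ ∈ I, HasDerivAt E1 (P1 θ / gam P1 P2 θ) θ)
    (hp1 : ∀ θ ∈ I, HasDerivAt p1
      (-(q1v P1 P2 p1 p2 θ) * p1 θ - B0 * q2v P1 P2 p1 p2 θ - e θ) θ)
    (hp2 : ∀ θ ∈ I, HasDerivAt p2
      (-(q1v P1 P2 p1 p2 θ) * p2 θ + B0 * q1v P1 P2 p1 p2 θ) θ)
    (he : ∀ θ ∈ I, HasDerivAt e ((1 - e θ) * q1v P1 P2 p1 p2 θ) θ)
    (hp1ne : ∀ θ ∈ I, p1 θ ≠ 0)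
    (hrel : ∀ θ ∈ I, p2 θ - B0 = C1 * (e θ - 1)) :
    (∀ θ ∈ I, HasDerivAt (fun t => e t / p1 t)
      ((1 + B0 ^ 2 * F1v P1 P2 θ) * (e θ / p1 θ) ^ 2
        + B0 * (C1 - B0) * F1v P1 P2 θ * (e θ / p1 θ) * ((e θ - 1) / p1 θ)
        - 2 * B0 * F2v P1 P2 θ * (e θ / p1 θ)
        - (C1 - B0) * F2v P1 P2 θ * ((e θ - 1) / p1 θ)
        + F3v P1 P2 θ) θ) ∧
    (∀ θ ∈ I, HasDerivAt (fun t => (e t - 1) / p1 t)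
      ((1 + B0 ^ 2 * F1v P1 P2 θ) * (e θ / p1 θ) * ((e θ - 1) / p1 θ)
        + B0 * (C1 - B0) * F1v P1 P2 θ * ((e θ - 1) / p1 θ) ^ 2
        - B0 * F2v P1 P2 θ * ((e θ - 1) / p1 θ)) θ) := by
  constructor
  · intro θ hθ
    have hne := hp1ne θ hθ
    have hp2eq : p2 θ = B0 + C1 * (e θ - 1) := by linarith [hrel θ hθ]
    refine ((he θ hθ).fun_div (hp1 θ hθ) hne).congr_deriv ?_
    rw [q1v_eq, q2v_eq, hp2eq]
    field_simp
    ring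
  · intro θ hθ
    have hne := hp1ne θ hθ
    have hp2eq : p2 θ = B0 + C1 * (e θ - 1) := by linarith [hrel θ hθ]
    refine (((he θ hθ).sub_const 1).fun_div (hp1 θ hθ) hne).congr_deriv ?_
    rw [q1v_eq, q2v_eq, hp2eq]
    field_simp
    ring
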